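/- There exist a constant C > 0 and n₀ ∈ ℕ such that the following holds for every finite simple graph with n̄ ≥ n₀ vertices and m̄ edges satisfying 2m̄ ≥ n̄ and deg(u) < m̄/√n̄ for every vertex u: let t = ⌊√n̄ / (30 log₂ n̄)⌋ (assumed ≥ 1), and let each vertex independently and uniformly choose a label in [t], with V_i denoting the set of vertices with label i; then with probability at least 1 − 1/n̄, for all i, j ∈ [t] the number of edges with one endpoint in V_i and the other endpoint in V_j is at most C · m̄ (log₂ n̄)² / n̄. -/

import Mathlib

open MeasureTheory

section PredictableConcentration

variable {V α : Type*} [Fintype V] [DecidableEq V] [Fintype α]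

/-- Averaging a function over one resampled coordinate does not change its total sum. -/
lemma sum_sum_update (H : (V → α) → ℝ) (a : V) :
    ∑ ω : V → α, ∑ c : α, H (Function.update ω a c) = Fintype.card α * ∑ ω, H ω := by
  classical
  have key : ∑ p : (V → α) × α, H (Function.update p.1 a p.2) =
      ∑ p : (V → α) × α, H p.1 := by
    refine Finset.sum_nbij' (fun p => (Function.update p.1 a p.2, p.1 a))
      (fun p => (Function.update p.1 a p.2, p.1 a)) ?_ ?_ ?_ ?_ ?_ <;> simp
  rw [← Fintype.sum_prod_type', key, Fintype.sum_prod_type, Finset.mul_sum]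
  simp

/-- If each factor only depends on the coordinates up to its own rank, and has average at most
one over its own coordinate, then the product has average at most one. -/
lemma sum_prod_le_card (r : V → ℕ) (F : V → (V → α) → ℝ) (hF0 : ∀ k ω, 0 ≤ F k ω)
    (hF : ∀ k a ω c, k ≠ a → r k ≤ r a → F k (Function.update ω a c) = F k ω)
    (hav : ∀ k ω, ∑ c, F k (Function.update ω k c) ≤ Fintype.card α) (s : Finset V) :
    ∑ ω, ∏ k ∈ s, F k ω ≤ (Fintype.card (V → α) : ℝ) := by
  induction s using Finset.induction_on_max_value r with
  | empty => simp
  | insert a s has hmax ih =>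
    refine le_trans ?_ ih
    rcases isEmpty_or_nonempty α with hα | hα
    · have : Nonempty V := ⟨a⟩
      simp
    have hq : (0 : ℝ) < Fintype.card α := by exact_mod_cast Fintype.card_pos
    refine le_of_mul_le_mul_left ?_ hq
    rw [← sum_sum_update _ a, Finset.mul_sum]
    refine Finset.sum_le_sum fun ω _ => ?_
    have : ∀ c, ∏ k ∈ insert a s, F k (Function.update ω a c) =
        F a (Function.update ω a c) * ∏ k ∈ s, F k ω := by
      intro c
      rw [Finset.prod_insert has]
      congr 1
      refine Finset.prod_congr rfl fun k hk => hF k a ω c ?_ (hmax k hk)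
      rintro rfl
      exact has hk
    simp_rw [this]
    rw [← Finset.sum_mul]
    exact mul_le_mul_of_nonneg_right (hav a ω) (Finset.prod_nonneg fun k _ => hF0 k ω)

lemma sum_exp_indicator_le [DecidableEq α] [Nonempty α] (i : α) {u : ℝ} (hu0 : 0 ≤ u)
    (hu1 : u ≤ 1) :
    ∑ c : α, Real.exp ((if c = i then u else 0) - 2 / Fintype.card α * u)
      ≤ Fintype.card α := by
  have hq : (0 : ℝ) < Fintype.card α := by exact_mod_cast Fintype.card_pos
  set q : ℝ := (Fintype.card α : ℝ)
  have h1 : ∀ c : α, Real.exp ((if c = i then u else 0) - 2 / q * u) ≤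
      (1 + if c = i then 2 * u else 0) * Real.exp (-(2 / q * u)) := by
    intro c
    rw [sub_eq_add_neg, Real.exp_add]
    refine mul_le_mul_of_nonneg_right ?_ (Real.exp_pos _).le
    split_ifs
    · have := (abs_le.1 (Real.abs_exp_sub_one_sub_id_le (abs_le.2 ⟨by linarith, hu1⟩))).2
      nlinarith
    · simp
  refine (Finset.sum_le_sum fun c _ => h1 c).trans ?_
  rw [← Finset.sum_mul, Finset.sum_add_distrib]
  simp only [Finset.sum_const, Finset.card_univ, nsmul_eq_mul, mul_one, Finset.sum_ite_eq',
    Finset.mem_univ, if_true]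
  rw [Real.exp_neg, ← div_eq_mul_inv, div_le_iff₀ (Real.exp_pos _)]
  have h2 := Real.add_one_le_exp (2 / q * u)
  calc q + 2 * u = q * (2 / q * u + 1) := by field_simp; ring
    _ ≤ _ := mul_le_mul_of_nonneg_left h2 hq.le

/-- Chernoff bound for sums of bounded predictable weights over the vertices with label `i`. -/
lemma card_predictable_sum_gt_le [DecidableEq α] [Nonempty α] (r : V → ℕ)
    (w : V → (V → α) → ℝ)
    (hw : ∀ k a ω c, r k ≤ r a → w k (Function.update ω a c) = w k ω)
    {B : ℝ} (hB : 0 < B) (hw0 : ∀ k ω, 0 ≤ w k ω) (hwB : ∀ k ω, w k ω ≤ B) (i : α) (L : ℝ) :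
    (({ω | 2 / Fintype.card α * ∑ k, w k ω + B * L <
        ∑ k, if ω k = i then w k ω else 0} : Finset (V → α)).card : ℝ)
      ≤ Fintype.card (V → α) * Real.exp (-L) := by
  set q : ℝ := (Fintype.card α : ℝ)
  let F : V → (V → α) → ℝ := fun k ω =>
    Real.exp ((if ω k = i then w k ω / B else 0) - 2 / q * (w k ω / B))
  have hsum : ∑ ω, ∏ k, F k ω ≤ (Fintype.card (V → α) : ℝ) := by
    refine sum_prod_le_card r F (fun _ _ => (Real.exp_pos _).le) ?_ ?_ _
    · intro k a ω c hka hr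
      simp only [F, hw k a ω c hr, Function.update_of_ne hka]
    · intro k ω
      simp only [F, hw k k ω _ le_rfl, Function.update_self]
      exact sum_exp_indicator_le i (div_nonneg (hw0 k ω) hB.le)
        ((div_le_one hB).2 (hwB k ω))
  rw [Real.exp_neg, ← div_eq_mul_inv, le_div_iff₀ (Real.exp_pos _)]
  refine le_trans ?_ hsum
  rw [← nsmul_eq_mul]
  refine (Finset.card_nsmul_le_sum _ (fun ω => ∏ k, F k ω) _ ?_).trans
    (Finset.sum_le_sum_of_subset_of_nonneg (Finset.subset_univ _)
      fun ω _ _ => Finset.prod_nonneg fun k _ => (Real.exp_pos _).le)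
  intro ω hω
  rw [Finset.mem_filter] at hω
  simp only [F]
  rw [← Real.exp_sum, Real.exp_le_exp, Finset.sum_sub_distrib, ← Finset.mul_sum,
    ← Finset.sum_div]
  have h3 : (∑ k, if ω k = i then w k ω / B else 0) =
      (∑ k, if ω k = i then w k ω else 0) / B := by
    rw [Finset.sum_div]
    exact Finset.sum_congr rfl fun k _ => by split_ifs <;> simp
  rw [h3, ← mul_div_assoc, ← sub_div, le_div_iff₀ hB]
  linarith [hω.2]

/-- Union bound over a finite family of instances of `card_predictable_sum_gt_le`: outside a small
exceptional set of labelings, all the sums are close to their predictable means. -/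
lemma exists_finset_predictable_sum_le [DecidableEq α] [Nonempty α] {ι : Type*} [Fintype ι]
    (r : V → ℕ) (w : ι → V → (V → α) → ℝ)
    (hw : ∀ x k a ω c, r k ≤ r a → w x k (Function.update ω a c) = w x k ω)
    {B : ℝ} (hB : 0 < B) (hw0 : ∀ x k ω, 0 ≤ w x k ω) (hwB : ∀ x k ω, w x k ω ≤ B)
    (i : ι → α) (L : ℝ) :
    ∃ S : Finset (V → α),
      (S.card : ℝ) ≤ Fintype.card ι * (Fintype.card (V → α) * Real.exp (-L)) ∧
      ∀ ω, ω ∉ S → ∀ x, (∑ k, if ω k = i x then w x k ω else 0) ≤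
        2 / Fintype.card α * ∑ k, w x k ω + B * L := by
  classical
  refine ⟨Finset.univ.biUnion fun x => {ω | 2 / Fintype.card α * ∑ k, w x k ω + B * L <
        ∑ k, if ω k = i x then w x k ω else 0}, ?_, fun ω hω x => ?_⟩
  · refine (Nat.cast_le.2 Finset.card_biUnion_le).trans ?_
    rw [Nat.cast_sum]
    refine (Finset.sum_le_sum fun x _ =>
      card_predictable_sum_gt_le r (w x) (hw x) hB (hw0 x) (hwB x) (i x) L).trans ?_
    simp
  · by_contra! h
    exact hω (by simpa using ⟨x, h⟩)

end PredictableConcentration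

section BackDegree

variable {V α : Type*} [Fintype V] [DecidableEq α] (G : SimpleGraph V) [DecidableRel G.Adj]
  (r : V → ℕ)

/-- The number of neighbors of `k` of smaller rank with label `j`. -/
def backDegree (j : α) (k : V) (ω : V → α) : ℕ :=
  Finset.card {b | G.Adj k b ∧ r b < r k ∧ ω b = j}

lemma backDegree_update [DecidableEq V] (j : α) {k a : V} (ω : V → α) (c : α)
    (h : r k ≤ r a) :
    backDegree G r j k (Function.update ω a c) = backDegree G r j k ω := by
  unfold backDegree
  congr 1
  refine Finset.filter_congr fun b _ => ?_
  refine and_congr_right fun _ => and_congr_right fun hb => ?_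
  rw [Function.update_of_ne]
  rintro rfl
  omega

lemma backDegree_le (j : α) (k : V) (ω : V → α) :
    (backDegree G r j k ω : ℝ) ≤
      ∑ b, if ω b = j then (if G.Adj k b then 1 else 0 : ℝ) else 0 := by
  unfold backDegree
  rw [Finset.card_filter, Nat.cast_sum]
  refine Finset.sum_le_sum fun b _ => ?_
  split_ifs <;> simp_all

lemma sum_backDegree_le (j : α) (ω : V → α) :
    ∑ k, (backDegree G r j k ω : ℝ) ≤ ∑ b, if ω b = j then (G.degree b : ℝ) else 0 := by
  refine (Finset.sum_le_sum fun k _ => backDegree_le G r j k ω).trans ?_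
  rw [Finset.sum_comm]
  refine Finset.sum_le_sum fun b _ => ?_
  split_ifs
  · simp_rw [G.adj_comm _ b]
    rw [Finset.sum_boole, ← G.card_neighborFinset_eq_degree, G.neighborFinset_eq_filter]
  · simp

lemma ncard_edges_between_le (hr : Function.Injective r) (i j : α) (ω : V → α) :
    ({e | e ∈ G.edgeSet ∧ ∃ a b, e = s(a, b) ∧ ω a = i ∧ ω b = j} : Set (Sym2 V)).ncard ≤
      (∑ k, if ω k = i then backDegree G r j k ω else 0) +
        ∑ k, if ω k = j then backDegree G r i k ω else 0 := by
  classical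
  let P : α → α → Finset (V × V) := fun i j =>
    {p | ω p.1 = i ∧ G.Adj p.1 p.2 ∧ r p.2 < r p.1 ∧ ω p.2 = j}
  have hP : ∀ i j, (P i j).card = ∑ k, if ω k = i then backDegree G r j k ω else 0 := by
    intro i j
    simp only [P, Finset.card_filter, Fintype.sum_prod_type, backDegree]
    refine Finset.sum_congr rfl fun k _ => ?_
    split_ifs with h <;> simp [h]
  rw [← hP, ← hP]
  refine le_trans ?_ (Finset.card_union_le _ _)
  refine le_trans ?_ (Finset.card_image_le (f := fun p : V × V => s(p.1, p.2)))
  rw [← Set.ncard_coe_finset]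
  refine Set.ncard_le_ncard ?_ (Finset.finite_toSet _)
  rintro e ⟨he, a, b, rfl, ha, hb⟩
  rw [SimpleGraph.mem_edgeSet] at he
  simp only [Finset.coe_image, Set.mem_image, Finset.mem_coe, Finset.mem_union, P,
    Finset.mem_filter, Finset.mem_univ, true_and]
  rcases lt_or_gt_of_ne (hr.ne he.ne) with h | h
  · exact ⟨(b, a), Or.inr ⟨hb, he.symm, h, ha⟩, Sym2.eq_swap⟩
  · exact ⟨(a, b), Or.inl ⟨ha, he, h, hb⟩, rfl⟩

lemma ncard_edges_between_le_of_concentration (hr : Function.Injective r) (ω : V → α)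
    {p L D W : ℝ} (hp : 0 ≤ p) (hD : ∀ v, (G.degree v : ℝ) ≤ D) (hW : p * D + L ≤ W)
    (h₁ : ∀ v j, (∑ b, if ω b = j then (if G.Adj v b then 1 else 0 : ℝ) else 0) ≤
      p * (∑ b, if G.Adj v b then 1 else 0) + 1 * L)
    (h₂ : ∀ j, (∑ b, if ω b = j then (G.degree b : ℝ) else 0) ≤
      p * (∑ b, (G.degree b : ℝ)) + D * L)
    (h₃ : ∀ i j, (∑ k, if ω k = i then min W (backDegree G r j k ω : ℝ) else 0) ≤
      p * (∑ k, min W (backDegree G r j k ω : ℝ)) + W * L) (i j : α) :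
    (({e | e ∈ G.edgeSet ∧ ∃ a b, e = s(a, b) ∧ ω a = i ∧ ω b = j} :
        Set (Sym2 V)).ncard : ℝ) ≤
      2 * (p * (p * (2 * G.edgeFinset.card) + D * L) + W * L) := by
  have hback : ∀ j k, (backDegree G r j k ω : ℝ) ≤ W := fun j k => by
    refine (backDegree_le G r j k ω).trans ((h₁ k j).trans ?_)
    rw [Finset.sum_boole, ← G.neighborFinset_eq_filter, G.card_neighborFinset_eq_degree]
    linarith [mul_le_mul_of_nonneg_left (hD k) hp]
  have hdeg : ∑ b, (G.degree b : ℝ) = 2 * G.edgeFinset.card := by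
    exact_mod_cast G.sum_degrees_eq_twice_card_edges
  have hhalf : ∀ i j, (∑ k, if ω k = i then (backDegree G r j k ω : ℝ) else 0) ≤
      p * (p * (2 * G.edgeFinset.card) + D * L) + W * L := fun i j => by
    have h := h₃ i j
    simp only [min_eq_right (hback j _)] at h
    rw [← hdeg]
    have := mul_le_mul_of_nonneg_left ((sum_backDegree_le G r j ω).trans (h₂ j)) hp
    linarith
  have h := Nat.cast_le (α := ℝ).2 (ncard_edges_between_le G r hr i j ω)
  push_cast at h
  linarith [hhalf i j, hhalf j i]

end BackDegree

/-- The product of uniform measures is the normalized counting measure. -/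
lemma pi_uniformOfFintype_apply {V α : Type*} [Fintype V] [Fintype α] [Nonempty α]
    [MeasurableSpace α] [MeasurableSingletonClass α] (S : Finset (V → α)) :
    Measure.pi (fun _ : V => (PMF.uniformOfFintype α).toMeasure) (S : Set (V → α)) =
      ENNReal.ofReal (S.card / (Fintype.card α : ℝ) ^ Fintype.card V) := by
  have hq : (0 : ℝ) < Fintype.card α := by exact_mod_cast Fintype.card_pos
  rw [← MeasureTheory.sum_measure_singleton]
  simp only [Measure.pi_singleton, PMF.toMeasure_apply_singleton _ _ (measurableSet_singleton _),
    PMF.uniformOfFintype_apply, Finset.prod_const, Finset.sum_const, Finset.card_univ,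
    nsmul_eq_mul]
  rw [ENNReal.ofReal_div_of_pos (by positivity), ENNReal.ofReal_natCast,
    ENNReal.ofReal_pow hq.le, ENNReal.ofReal_natCast, ← ENNReal.inv_pow, div_eq_mul_inv]

lemma two_stage_bound_le {n m l p L D W : ℝ} (hn : 0 < n) (hm : 0 < m) (hl : 0 < l)
    (hp0 : 0 ≤ p) (hp : p ≤ 120 * l / √n) (hL : L ≤ 4 * l) (hD : D = m / √n)
    (hpD : p * D ≤ 120 * l * (m / n)) (hWmn : W = 128 * l * (m / n)) :
    2 * (p * (p * (2 * m) + D * L) + W * L) ≤ 60000 * m * l ^ 2 / n := by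
  have hD0 : 0 ≤ D := by
    rw [hD]
    positivity
  have hmn0 : 0 ≤ m / n := by positivity
  have hinner : p * (2 * m) + D * L ≤ 244 * l * D := by
    have h₄ := mul_le_mul_of_nonneg_right hp (by positivity : 0 ≤ 2 * m)
    have h₅ : 120 * l / √n * (2 * m) = 240 * l * D := by
      rw [hD]
      ring
    nlinarith
  have houter : p * (p * (2 * m) + D * L) ≤ 29280 * l ^ 2 * (m / n) := by
    calc p * (p * (2 * m) + D * L)
        ≤ p * (244 * l * D) := mul_le_mul_of_nonneg_left hinner (by positivity)
      _ = 244 * l * (p * D) := by ring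
      _ ≤ 244 * l * (120 * l * (m / n)) := mul_le_mul_of_nonneg_left hpD (by positivity)
      _ = _ := by ring
  have hWL : W * L ≤ 512 * l ^ 2 * (m / n) := by
    calc W * L ≤ W * (4 * l) := mul_le_mul_of_nonneg_left hL (hWmn ▸ by positivity)
      _ = _ := by
        rw [hWmn]
        ring
  have hnonneg : 0 ≤ l ^ 2 * (m / n) := by positivity
  calc 2 * (p * (p * (2 * m) + D * L) + W * L)
      ≤ 2 * (29280 * l ^ 2 * (m / n) + 512 * l ^ 2 * (m / n)) := by linarith
    _ ≤ 60000 * (l ^ 2 * (m / n)) := by linarith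
    _ = _ := by ring

lemma union_bound_mul_le {n t T : ℝ} (hn : 3 ≤ n) (ht : 0 ≤ t) (htn : t ≤ n) (hT : 0 ≤ T) :
    (n * t + t + t * t) * (T * (1 / n ^ 4)) ≤ 1 / n * T := by
  have hcount : n * t + t + t * t ≤ n ^ 3 := by
    calc n * t + t + t * t ≤ n * n + n * n + n * n := by gcongr; nlinarith
      _ = 3 * n ^ 2 := by ring
      _ ≤ n * n ^ 2 := by gcongr
      _ = n ^ 3 := by ring
  calc (n * t + t + t * t) * (T * (1 / n ^ 4)) ≤ n ^ 3 * (T * (1 / n ^ 4)) := by gcongr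
    _ = 1 / n * T := by field_simp

/-- There exist `C > 0` and `n₀` such that for every finite simple graph with `n̄ ≥ n₀`
vertices and `m̄` edges satisfying `2m̄ ≥ n̄` and `deg(u) < m̄/√n̄` for every vertex `u`:
with `t = ⌊√n̄ / (30 log₂ n̄)⌋` (assumed `≥ 1`), if each vertex independently and uniformly
chooses a label in `[t]` (product of uniform measures on `V → Fin t`), then with probability
at least `1 − 1/n̄`, for all labels `i, j` the number of edges with one endpoint labeled `i`
and the other labeled `j` is at most `C · m̄ (log₂ n̄)² / n̄`. -/
theorem stmt8 :
    ∃ C : ℝ, 0 < C ∧ ∃ n₀ : ℕ, ∀ (V : Type) [Fintype V] [DecidableEq V]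
      (G : SimpleGraph V) [DecidableRel G.Adj] (t : ℕ) (ht1 : 1 ≤ t),
      n₀ ≤ Fintype.card V →
      (Fintype.card V : ℝ) ≤ 2 * (G.edgeFinset.card : ℝ) →
      (∀ u : V, (G.degree u : ℝ) <
          (G.edgeFinset.card : ℝ) / Real.sqrt (Fintype.card V)) →
      t = ⌊Real.sqrt (Fintype.card V) / (30 * Real.logb 2 (Fintype.card V))⌋₊ →
      ENNReal.ofReal (1 - 1 / (Fintype.card V : ℝ)) ≤
        Measure.pi
          (fun _ : V => (@PMF.uniformOfFintype (Fin t) _ ⟨⟨0, ht1⟩⟩).toMeasure)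
          {ω : V → Fin t | ∀ i j : Fin t,
            (({e | e ∈ G.edgeSet ∧ ∃ a b, e = s(a, b) ∧ ω a = i ∧ ω b = j} :
                Set (Sym2 V)).ncard : ℝ)
              ≤ C * (G.edgeFinset.card : ℝ) * (Real.logb 2 (Fintype.card V)) ^ 2
                  / (Fintype.card V : ℝ)} := by
  classical
  refine ⟨60000, by norm_num, 3, ?_⟩
  intro V _ _ G _ t ht1 hn3 hm hdeg ht
  have : Nonempty (Fin t) := ⟨⟨0, ht1⟩⟩
  set n : ℝ := (Fintype.card V : ℝ) with hn
  set m : ℝ := (G.edgeFinset.card : ℝ) with hmdef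
  set l : ℝ := Real.logb 2 n with hl
  have hn3' : (3 : ℝ) ≤ n := by rw [hn]; exact_mod_cast hn3
  have hs0 : 0 < √n := Real.sqrt_pos.2 (by linarith)
  have hss : √n * √n = n := Real.mul_self_sqrt (by linarith)
  have hl1 : 1 ≤ l := by
    rw [hl, Real.le_logb_iff_rpow_le one_lt_two (by linarith)]
    norm_num
    linarith
  have hm0 : 0 < m := by linarith
  have ht1' : (1 : ℝ) ≤ t := by exact_mod_cast ht1
  have hx0 : 0 ≤ √n / (30 * l) := by positivity
  have htx : (t : ℝ) ≤ √n / (30 * l) := ht ▸ Nat.floor_le hx0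
  have hxt : √n / (30 * l) < t + 1 := ht ▸ Nat.lt_floor_add_one _
  have htn : (t : ℝ) ≤ n := by
    have h1 : √n / (30 * l) ≤ √n := div_le_self hs0.le (by linarith)
    nlinarith
  have hp : 2 / (t : ℝ) ≤ 120 * l / √n := by
    rw [div_le_div_iff₀ (by linarith) hs0]
    rw [div_lt_iff₀ (by positivity)] at hxt
    nlinarith
  have hL0 : 0 ≤ Real.log n := Real.log_nonneg (by linarith)
  have hLl : Real.log n ≤ l := by
    rw [hl, Real.logb, le_div_iff₀ (Real.log_pos one_lt_two)]
    nlinarith [Real.log_two_lt_d9]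
  set L : ℝ := 4 * Real.log n with hLdef
  have hexp : Real.exp (-L) = 1 / n ^ 4 := by
    rw [Real.exp_neg, hLdef, show (4 : ℝ) * Real.log n = ((4 : ℕ) : ℝ) * Real.log n by norm_num,
      Real.exp_nat_mul, Real.exp_log (by linarith), one_div]
  set D : ℝ := m / √n with hD
  have hD0 : 0 < D := by positivity
  set W : ℝ := 128 * l * m / n with hWdef
  have hW0 : 0 < W := by positivity
  have hDn : 1 / √n * D = m / n := by
    rw [hD, div_mul_div_comm, one_mul, hss]
  have hmn : 1 / 2 ≤ m / n := by
    rw [le_div_iff₀ (by linarith)]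
    linarith
  have hpD : 2 / (t : ℝ) * D ≤ 120 * l * (m / n) := by
    calc 2 / (t : ℝ) * D ≤ 120 * l / √n * D := mul_le_mul_of_nonneg_right hp hD0.le
      _ = 120 * l * (1 / √n * D) := by ring
      _ = _ := by rw [hDn]
  have hWmn : W = 128 * l * (m / n) := by rw [hWdef, mul_div_assoc]
  have hW : 2 / (t : ℝ) * D + L ≤ W := by
    rw [hWmn]
    nlinarith
  let e := Fintype.equivFin V
  let r : V → ℕ := fun v => e v
  have hr : Function.Injective r := Fin.val_injective.comp e.injective
  obtain ⟨S₁, hc₁, h₁⟩ := exists_finset_predictable_sum_le (α := Fin t) (ι := V × Fin t) r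
    (fun x b _ => if G.Adj x.1 b then 1 else 0) (fun _ _ _ _ _ _ => rfl) one_pos
    (fun _ _ _ => by split_ifs <;> norm_num) (fun _ _ _ => by split_ifs <;> norm_num)
    (fun x => x.2) L
  obtain ⟨S₂, hc₂, h₂⟩ := exists_finset_predictable_sum_le (α := Fin t) (ι := Fin t) r
    (fun _ b _ => (G.degree b : ℝ)) (fun _ _ _ _ _ _ => rfl) hD0
    (fun _ _ _ => Nat.cast_nonneg _) (fun _ b _ => (hdeg b).le) (fun x => x) L
  obtain ⟨S₃, hc₃, h₃⟩ := exists_finset_predictable_sum_le (α := Fin t) (ι := Fin t × Fin t) r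
    (fun x k ω => min W (backDegree G r x.2 k ω : ℝ))
    (fun x k a ω c h => by simp only [backDegree_update G r x.2 ω c h]) hW0
    (fun _ _ _ => le_min hW0.le (Nat.cast_nonneg _)) (fun _ _ _ => min_le_left _ _)
    (fun x => x.1) L
  have hgood : (((S₁ ∪ S₂ ∪ S₃)ᶜ : Finset (V → Fin t)) : Set (V → Fin t)) ⊆
      {ω : V → Fin t | ∀ i j : Fin t,
        (({e | e ∈ G.edgeSet ∧ ∃ a b, e = s(a, b) ∧ ω a = i ∧ ω b = j} :
          Set (Sym2 V)).ncard : ℝ) ≤ 60000 * m * l ^ 2 / n} := by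
    intro ω hω i j
    simp only [Finset.coe_compl, Finset.coe_union, Set.mem_compl_iff, Set.mem_union,
      Finset.mem_coe, not_or] at hω
    obtain ⟨⟨hω₁, hω₂⟩, hω₃⟩ := hω
    simp only [Fintype.card_fin] at h₁ h₂ h₃
    refine (ncard_edges_between_le_of_concentration G r hr ω (by positivity)
      (fun v => (hdeg v).le) hW (fun v j => h₁ ω hω₁ (v, j)) (fun j => h₂ ω hω₂ j)
      (fun i j => h₃ ω hω₃ (i, j)) i j).trans ?_
    exact two_stage_bound_le (by linarith) hm0 (by linarith) (by positivity) hp (by linarith) hD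
      hpD hWmn
  refine le_trans ?_ (measure_mono hgood)
  rw [pi_uniformOfFintype_apply]
  refine ENNReal.ofReal_le_ofReal ?_
  have hT : (Fintype.card (V → Fin t) : ℝ) = (t : ℝ) ^ Fintype.card V := by simp
  rw [Finset.card_compl, Nat.cast_sub (Finset.card_le_univ _), hT, Fintype.card_fin]
  simp only [Fintype.card_prod, Fintype.card_fin, Nat.cast_mul, hT, hexp] at hc₁ hc₂ hc₃
  set T : ℝ := (t : ℝ) ^ Fintype.card V
  have hT0 : 0 < T := by positivity
  have hunion : ((S₁ ∪ S₂ ∪ S₃).card : ℝ) ≤ S₁.card + S₂.card + S₃.card := by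
    exact_mod_cast (Finset.card_union_le _ _).trans
      (Nat.add_le_add_right (Finset.card_union_le _ _) _)
  have hbad := union_bound_mul_le hn3' (by positivity) htn hT0.le
  rw [le_div_iff₀ hT0]
  linarith
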